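/- arXiv:2302.14123 — 3 statements merged into one kernel-verified Lean document; each statement's English description precedes it below -/
import Mathlib

section
/- For the median outcome function with β_a ≠ β_b, empty-item cost c ≥ (1/2)·|β_a − β_b|, m ≥ 2 items, and n_a ≥ n_b ≥ 2·(m − 1): there exists a Nash stable arrangement whose misallocated effort is at least (n_a + n_b)/4. -/
open Finset

/-- Median outcome on an item with `ai` type-A agents (bias `βa`) and `bi` type-B agents
(bias `βb`): `βa` if `ai > bi`, `βb` if `ai < bi`, the average if they tie. -/
noncomputable def medOut (βa βb : ℝ) (ai bi : ℕ) : ℝ :=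
  if bi < ai then βa else if ai < bi then βb else (βa + βb) / 2

/-- Mean outcome on an item with `ai` type-A agents and `bi` type-B agents. -/
noncomputable def meanOut (βa βb : ℝ) (ai bi : ℕ) : ℝ :=
  ((ai : ℝ) * βa + (bi : ℝ) * βb) / ((ai : ℝ) + (bi : ℝ))

/-- Total cost, with per-item outcome function `f` (applied to the counts on each item),
to an agent of bias `β`, with empty-item cost `c`. -/
noncomputable def pbCost {m : ℕ} (f : ℕ → ℕ → ℝ) (β c : ℝ) (a b : Fin m → ℕ) : ℝ :=
  ∑ i, if a i + b i = 0 then c else |f (a i) (b i) - β|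

/-- Move one agent from item `i` to item `j`. -/
def pbMove {m : ℕ} (x : Fin m → ℕ) (i j : Fin m) : Fin m → ℕ :=
  Function.update (Function.update x i (x i - 1)) j (x j + 1)

/-- Nash stability: no single agent can strictly decrease its own total cost by
moving from one item to another. -/
def NashStable {m : ℕ} (f : ℕ → ℕ → ℝ) (βa βb c : ℝ) (a b : Fin m → ℕ) : Prop :=
  ∀ i j : Fin m, i ≠ j →
    (1 ≤ a i → pbCost f βa c a b ≤ pbCost f βa c (pbMove a i j) b) ∧
    (1 ≤ b i → pbCost f βb c a b ≤ pbCost f βb c a (pbMove b i j))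

/-- The median-critical region of `(n_a, n_b)` pairs for `m` items. -/
def MedianCritical (m na nb : ℕ) : Prop :=
  (na + nb ≤ 2 * m ∧ m < na ∧ 1 ≤ nb ∧ nb + m < na) ∨
  (na + nb ≤ 2 * m ∧ m < nb ∧ 1 ≤ na ∧ na + m < nb)

/-- The total cost under the median outcome only depends on which items are empty and on which
type holds the majority on each item. -/
theorem pbCost_medOut_congr {m : ℕ} {βa βb β c : ℝ} {a b a' b' : Fin m → ℕ}
    (h : ∀ k, (a k + b k = 0 ↔ a' k + b' k = 0) ∧ (b k < a k ↔ b' k < a' k) ∧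
      (a k < b k ↔ a' k < b' k)) :
    pbCost (medOut βa βb) β c a b = pbCost (medOut βa βb) β c a' b' := by
  unfold pbCost medOut
  refine Finset.sum_congr rfl fun k _ => ?_
  obtain ⟨h₁, h₂, h₃⟩ := h k
  simp only [h₁, h₂, h₃]

/-- median outcome, `β_a ≠ β_b`, `c ≥ (1/2)·|β_a − β_b|`, `m ≥ 2`,
`n_a ≥ n_b ≥ 2(m − 1)`: there is a Nash stable arrangement with misallocated effort
at least `(n_a + n_b)/4`. -/
theorem stmt9 (m : ℕ) (hm : 2 ≤ m) (βa βb c : ℝ) (hβ : βa ≠ βb)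
    (hc : (1 / 2) * |βa - βb| ≤ c) (na nb : ℕ)
    (hab : nb ≤ na) (hnb : 2 * (m - 1) ≤ nb) :
    ∃ a b : Fin m → ℕ, (∑ i, a i = na) ∧ (∑ i, b i = nb) ∧
      NashStable (medOut βa βb) βa βb c a b ∧
      ((na : ℝ) + (nb : ℝ)) / 4 ≤
        ∑ i, (|(a i : ℝ) - (na : ℝ) / (m : ℝ)| + |(b i : ℝ) - (nb : ℝ) / (m : ℝ)|) := by
  have h0 : 0 < m := by omega
  set o : Fin m := ⟨0, h0⟩
  refine ⟨fun i => if i = o then na else 0,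
    fun i => if i = o then nb - 2 * (m - 1) else 2, by simp, ?_, ?_, ?_⟩
  · rw [← Finset.add_sum_erase _ _ (Finset.mem_univ o),
      Finset.sum_congr rfl (g := fun _ => 2)
        fun i hi => if_neg (Finset.ne_of_mem_erase hi)]
    simp [Finset.card_erase_of_mem]
    omega
  · intro i j hij
    refine ⟨fun hi => le_of_eq ?_, fun hi => le_of_eq ?_⟩ <;>
    · refine pbCost_medOut_congr fun k => ?_
      simp only [pbMove, Function.update_apply] at hi ⊢
      by_cases hio : i = o <;> by_cases hjo : j = o <;> by_cases hko : k = o <;>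
        by_cases hkj : k = j <;> by_cases hki : k = i <;>
        simp_all <;> omega
  · refine le_trans ?_ (Finset.single_le_sum (fun i _ => by positivity) (Finset.mem_univ o))
    have hm' : (2 : ℝ) ≤ m := by exact_mod_cast hm
    have hab' : (nb : ℝ) ≤ na := by exact_mod_cast hab
    have hdiv : (na : ℝ) / m ≤ na / 2 := by gcongr
    simp only [if_true]
    have h₁ := le_abs_self ((na : ℝ) - na / m)
    have h₂ := abs_nonneg (((nb - 2 * (m - 1) : ℕ) : ℝ) - nb / m)
    linarith
end

section
/- For the mean outcome function with exactly three agents (n_a + n_b = 3) and m ≥ 4 items: for any real biases β_a, β_b and any empty-item cost c ≥ 0, a Nash stable arrangement always exists. -/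
open Finset

/-- Cost of a single item under the mean outcome, to an agent with `x` agents of its own type and
`y` of the other type on the item, when the biases are at distance `d`. -/
noncomputable def itemCost (d c : ℝ) (x y : ℕ) : ℝ :=
  if x + y = 0 then c else (y : ℝ) * d / ((x : ℝ) + (y : ℝ))

theorem meanOut_comm (βa βb : ℝ) (x y : ℕ) : meanOut βa βb x y = meanOut βb βa y x := by
  unfold meanOut
  congr 1 <;> ring

theorem pbCost_meanOut_comm {m : ℕ} (βa βb β c : ℝ) (a b : Fin m → ℕ) :
    pbCost (meanOut βa βb) β c a b = pbCost (meanOut βb βa) β c b a := by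
  unfold pbCost
  refine Finset.sum_congr rfl fun i _ => ?_
  rw [meanOut_comm, add_comm (a i)]

theorem NashStable.symm {m : ℕ} {βa βb c : ℝ} {a b : Fin m → ℕ}
    (h : NashStable (meanOut βa βb) βa βb c a b) :
    NashStable (meanOut βb βa) βb βa c b a := by
  intro i j hij
  simpa only [pbCost_meanOut_comm βb βa] using (h i j hij).symm

theorem pbCost_meanOut {m : ℕ} (βa βb c : ℝ) (a b : Fin m → ℕ) :
    pbCost (meanOut βa βb) βa c a b = ∑ i, itemCost |βb - βa| c (a i) (b i) := by
  unfold pbCost itemCost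
  refine Finset.sum_congr rfl fun i _ => ?_
  split_ifs with h
  · rfl
  have hpos : (0 : ℝ) < (a i : ℝ) + b i := by exact_mod_cast Nat.pos_of_ne_zero h
  have hout : meanOut βa βb (a i) (b i) - βa = (b i : ℝ) * (βb - βa) / ((a i : ℝ) + b i) := by
    unfold meanOut
    field_simp
    ring
  rw [hout, abs_div, abs_mul, abs_of_pos hpos, Nat.abs_cast]

/-- A move changes the cost only through its source and its target. -/
theorem sum_le_sum_pbMove {m : ℕ} (g : ℕ → ℕ → ℝ) (a b : Fin m → ℕ) {i j : Fin m} (hij : i ≠ j)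
    (h : g (a i) (b i) + g (a j) (b j) ≤ g (a i - 1) (b i) + g (a j + 1) (b j)) :
    ∑ k, g (a k) (b k) ≤ ∑ k, g (pbMove a i j k) (b k) := by
  have hj : j ∈ Finset.univ.erase i := by simp [hij.symm]
  rw [← Finset.add_sum_erase _ _ (Finset.mem_univ i), ← Finset.add_sum_erase _ _ hj,
    ← Finset.add_sum_erase _ (fun k => g (pbMove a i j k) (b k)) (Finset.mem_univ i),
    ← Finset.add_sum_erase _ (fun k => g (pbMove a i j k) (b k)) hj]
  have hrest : ∑ k ∈ (Finset.univ.erase i).erase j, g (pbMove a i j k) (b k) =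
      ∑ k ∈ (Finset.univ.erase i).erase j, g (a k) (b k) := by
    refine Finset.sum_congr rfl fun k hk => ?_
    simp only [Finset.mem_erase] at hk
    simp [pbMove, hk.1, hk.2.1]
  rw [hrest]
  simp only [pbMove, Function.update_self, Function.update_of_ne hij]
  linarith

/-- It suffices to check stability on the source and the target of each move. -/
theorem nashStable_meanOut_of_itemCost {m : ℕ} {βa βb c : ℝ} {a b : Fin m → ℕ}
    (h : ∀ i j : Fin m,
      (1 ≤ a i → itemCost |βb - βa| c (a i) (b i) + itemCost |βb - βa| c (a j) (b j) ≤
        itemCost |βb - βa| c (a i - 1) (b i) + itemCost |βb - βa| c (a j + 1) (b j)) ∧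
      (1 ≤ b i → itemCost |βb - βa| c (b i) (a i) + itemCost |βb - βa| c (b j) (a j) ≤
        itemCost |βb - βa| c (b i - 1) (a i) + itemCost |βb - βa| c (b j + 1) (a j))) :
    NashStable (meanOut βa βb) βa βb c a b := by
  intro i j hij
  constructor
  · intro hi
    rw [pbCost_meanOut, pbCost_meanOut]
    exact sum_le_sum_pbMove _ a b hij ((h i j).1 hi)
  · intro hi
    rw [pbCost_meanOut_comm βa βb, pbCost_meanOut_comm βa βb, pbCost_meanOut, pbCost_meanOut,
      abs_sub_comm]
    exact sum_le_sum_pbMove _ b a hij ((h i j).2 hi)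

/-- Three agents of the same type are stable on three separate items. -/
theorem exists_nashStable_three_zero (m : ℕ) (hm : 3 ≤ m) (βa βb c : ℝ) (hc : 0 ≤ c) :
    ∃ a b : Fin m → ℕ, (∑ i, a i = 3) ∧ (∑ i, b i = 0) ∧
      NashStable (meanOut βa βb) βa βb c a b := by
  let p : Fin m := ⟨0, by omega⟩
  let q : Fin m := ⟨1, by omega⟩
  let r : Fin m := ⟨2, by omega⟩
  have hpq : p ≠ q := by simp [p, q]
  have hpr : p ≠ r := by simp [p, r]
  have hqr : q ≠ r := by simp [q, r]
  refine ⟨Pi.single p 1 + Pi.single q 1 + Pi.single r 1, 0, ?_, ?_,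
    nashStable_meanOut_of_itemCost ?_⟩
  · simp [Finset.sum_add_distrib]
  · simp
  have hshape : ∀ i, (Pi.single p 1 + Pi.single q 1 + Pi.single r 1 : Fin m → ℕ) i = 1 ∨
      (Pi.single p 1 + Pi.single q 1 + Pi.single r 1 : Fin m → ℕ) i = 0 := by
    intro i
    simp only [Pi.add_apply, Pi.single_apply]
    grind
  intro i j
  rcases hshape i with hi | hi <;> rcases hshape j with hj | hj <;>
    rw [hi, hj] <;> norm_num [itemCost] <;> linarith

/-- Two agents against one: the stable arrangement isolates, pairs or gathers the agents according
to how `c` compares with `d / 2` and `d / 6`, where `d` is the distance between the biases. -/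
theorem exists_nashStable_two_one (m : ℕ) (hm : 3 ≤ m) (βa βb c : ℝ) (hc : 0 ≤ c) :
    ∃ a b : Fin m → ℕ, (∑ i, a i = 2) ∧ (∑ i, b i = 1) ∧
      NashStable (meanOut βa βb) βa βb c a b := by
  let p : Fin m := ⟨0, by omega⟩
  let q : Fin m := ⟨1, by omega⟩
  let r : Fin m := ⟨2, by omega⟩
  have hpq : p ≠ q := by simp [p, q]
  have hpr : p ≠ r := by simp [p, r]
  have hqr : q ≠ r := by simp [q, r]
  have hd : 0 ≤ |βb - βa| := abs_nonneg _
  rcases le_total (|βb - βa| / 2) c with h2 | h2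
  · refine ⟨Pi.single p 1 + Pi.single q 1, Pi.single r 1, ?_, ?_,
      nashStable_meanOut_of_itemCost ?_⟩
    · simp [Finset.sum_add_distrib]
    · simp
    generalize ha : (Pi.single p 1 + Pi.single q 1 : Fin m → ℕ) = a
    generalize hb : (Pi.single r 1 : Fin m → ℕ) = b
    have hshape : ∀ i, (a i = 1 ∧ b i = 0) ∨ (a i = 0 ∧ b i = 1) ∨ (a i = 0 ∧ b i = 0) := by
      intro i
      simp only [← ha, ← hb, Pi.add_apply, Pi.single_apply]
      grind
    intro i j
    rcases hshape i with ⟨hi, hi'⟩ | ⟨hi, hi'⟩ | ⟨hi, hi'⟩ <;>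
      rcases hshape j with ⟨hj, hj'⟩ | ⟨hj, hj'⟩ | ⟨hj, hj'⟩ <;>
      rw [hi, hj, hi', hj'] <;> norm_num [itemCost] <;> linarith
  rcases le_total (|βb - βa| / 6) c with h6 | h6
  · refine ⟨Pi.single p 1 + Pi.single q 1, Pi.single p 1, ?_, ?_,
      nashStable_meanOut_of_itemCost ?_⟩
    · simp [Finset.sum_add_distrib]
    · simp
    generalize ha : (Pi.single p 1 + Pi.single q 1 : Fin m → ℕ) = a
    generalize hb : (Pi.single p 1 : Fin m → ℕ) = b
    have hshape : ∀ i, (a i = 1 ∧ b i = 1) ∨ (a i = 1 ∧ b i = 0) ∨ (a i = 0 ∧ b i = 0) := by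
      intro i
      simp only [← ha, ← hb, Pi.add_apply, Pi.single_apply]
      grind
    intro i j
    rcases hshape i with ⟨hi, hi'⟩ | ⟨hi, hi'⟩ | ⟨hi, hi'⟩ <;>
      rcases hshape j with ⟨hj, hj'⟩ | ⟨hj, hj'⟩ | ⟨hj, hj'⟩ <;>
      rw [hi, hj, hi', hj'] <;> norm_num [itemCost] <;> linarith
  · refine ⟨Pi.single p 2, Pi.single p 1, ?_, ?_, nashStable_meanOut_of_itemCost ?_⟩
    · simp
    · simp
    generalize ha : (Pi.single p 2 : Fin m → ℕ) = a
    generalize hb : (Pi.single p 1 : Fin m → ℕ) = b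
    have hshape : ∀ i, (a i = 2 ∧ b i = 1) ∨ (a i = 0 ∧ b i = 0) := by
      intro i
      simp only [← ha, ← hb, Pi.single_apply]
      grind
    intro i j
    rcases hshape i with ⟨hi, hi'⟩ | ⟨hi, hi'⟩ <;>
      rcases hshape j with ⟨hj, hj'⟩ | ⟨hj, hj'⟩ <;>
      rw [hi, hj, hi', hj'] <;> norm_num [itemCost] <;> (try constructor) <;> linarith

/-- mean outcome, three agents total (`n_a + n_b = 3`), `m ≥ 4` items:
for any biases and any `c ≥ 0`, a Nash stable arrangement exists. -/
theorem stmt13 (m : ℕ) (hm : 4 ≤ m) (βa βb c : ℝ) (hc : 0 ≤ c)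
    (na nb : ℕ) (hn : na + nb = 3) :
    ∃ a b : Fin m → ℕ, (∑ i, a i = na) ∧ (∑ i, b i = nb) ∧
      NashStable (meanOut βa βb) βa βb c a b := by
  have hcases : na = 3 ∧ nb = 0 ∨ na = 2 ∧ nb = 1 ∨ na = 1 ∧ nb = 2 ∨ na = 0 ∧ nb = 3 := by omega
  rcases hcases with ⟨rfl, rfl⟩ | ⟨rfl, rfl⟩ | ⟨rfl, rfl⟩ | ⟨rfl, rfl⟩
  · exact exists_nashStable_three_zero m (by omega) βa βb c hc
  · exact exists_nashStable_two_one m (by omega) βa βb c hc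
  · obtain ⟨a, b, ha, hb, h⟩ := exists_nashStable_two_one m (by omega) βb βa c hc
    exact ⟨b, a, hb, ha, h.symm⟩
  · obtain ⟨a, b, ha, hb, h⟩ := exists_nashStable_three_zero m (by omega) βb βa c hc
    exact ⟨b, a, hb, ha, h.symm⟩
end

section
/- Suppose there are fewer agents than items (n_a + n_b < m) and the empty-item cost satisfies c ≥ (1/2)·|β_a − β_b|. Then every arrangement in which each item holds at most one agent (a_i + b_i ≤ 1 for all i) is Nash stable, both for the median and for the mean outcome function. -/
open Finset

/-- Two real families that agree off `{i, j}` have sums ordered as their sums over `{i, j}`. -/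
lemma sum_le_sum_of_pair {ι : Type*} [Fintype ι] {F G : ι → ℝ} {i j : ι}
    (hij : i ≠ j) (heq : ∀ k, k ≠ i → k ≠ j → F k = G k) (hle : F i + F j ≤ G i + G j) :
    ∑ k, F k ≤ ∑ k, G k := by
  classical
  have key : ∑ k, (G k - F k) = ∑ k ∈ {i, j}, (G k - F k) := by
    refine (Finset.sum_subset (Finset.subset_univ _) fun k _ hk => ?_).symm
    simp only [Finset.mem_insert, Finset.mem_singleton, not_or] at hk
    rw [heq k hk.1 hk.2, sub_self]
  rw [Finset.sum_pair hij, Finset.sum_sub_distrib] at key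
  linarith

lemma pbMove_source {m : ℕ} (x : Fin m → ℕ) {i j : Fin m} (hij : i ≠ j) :
    pbMove x i j i = x i - 1 := by
  simp [pbMove, hij]

lemma pbMove_target {m : ℕ} (x : Fin m → ℕ) (i j : Fin m) :
    pbMove x i j j = x j + 1 := by
  simp [pbMove]

lemma pbMove_of_ne {m : ℕ} (x : Fin m → ℕ) {i j k : Fin m} (hi : k ≠ i) (hj : k ≠ j) :
    pbMove x i j k = x k := by
  simp [pbMove, hi, hj]

/-- Only the outcomes on items with one or two agents matter for the stability of an arrangement
with at most one agent per item. -/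
lemma nashStable_of_le_one {m : ℕ} {βa βb c : ℝ} (hc : (1 / 2) * |βa - βb| ≤ c)
    {f : ℕ → ℕ → ℝ} (h10 : f 1 0 = βa) (h01 : f 0 1 = βb) (h20 : f 2 0 = βa) (h02 : f 0 2 = βb)
    (h11 : f 1 1 = (βa + βb) / 2) {a b : Fin m → ℕ} (h1 : ∀ i, a i + b i ≤ 1) :
    NashStable f βa βb c a b := by
  have hc0 : 0 ≤ c := le_trans (by positivity) hc
  have hA : |(βa + βb) / 2 - βa| = (1 / 2) * |βa - βb| := by
    rw [show (βa + βb) / 2 - βa = -((1 / 2) * (βa - βb)) by ring, abs_neg, abs_mul]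
    norm_num
  have hB : |(βa + βb) / 2 - βb| = (1 / 2) * |βa - βb| := by
    rw [show (βa + βb) / 2 - βb = (1 / 2) * (βa - βb) by ring, abs_mul]
    norm_num
  intro i j hij
  have hi := h1 i
  have hj := h1 j
  have hcases : (a j = 0 ∧ b j = 0) ∨ (a j = 1 ∧ b j = 0) ∨ (a j = 0 ∧ b j = 1) := by omega
  constructor
  · intro hai
    have hai' : a i = 1 := by omega
    have hbi : b i = 0 := by omega
    refine sum_le_sum_of_pair hij (fun k hki hkj => by rw [pbMove_of_ne a hki hkj]) ?_
    rw [pbMove_source a hij, pbMove_target, hai', hbi]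
    rcases hcases with ⟨h, h'⟩ | ⟨h, h'⟩ | ⟨h, h'⟩ <;> rw [h, h'] <;>
      simp [h10, h01, h20, h11, hA, hc0]
    rw [abs_sub_comm βb βa]
    linarith
  · intro hbi
    have hbi' : b i = 1 := by omega
    have hai : a i = 0 := by omega
    refine sum_le_sum_of_pair hij (fun k hki hkj => by rw [pbMove_of_ne b hki hkj]) ?_
    rw [pbMove_source b hij, pbMove_target, hbi', hai]
    rcases hcases with ⟨h, h'⟩ | ⟨h, h'⟩ | ⟨h, h'⟩ <;> rw [h, h'] <;>
      simp [h10, h01, h02, h11, hB, hc0]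
    linarith

/-- with fewer agents than items and `c ≥ (1/2)·|β_a − β_b|`, every
arrangement with at most one agent per item is Nash stable (median and mean outcome). -/
theorem stmt14 (m : ℕ) (hm : 0 < m) (βa βb c : ℝ) (na nb : ℕ)
    (hn : na + nb < m) (hc : (1 / 2) * |βa - βb| ≤ c)
    (f : ℕ → ℕ → ℝ) (hf : f = medOut βa βb ∨ f = meanOut βa βb)
    (a b : Fin m → ℕ) (ha : ∑ i, a i = na) (hb : ∑ i, b i = nb)
    (h1 : ∀ i, a i + b i ≤ 1) :
    NashStable f βa βb c a b := by
  rcases hf with rfl | rfl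
  · exact nashStable_of_le_one hc (by simp [medOut]) (by simp [medOut]) (by simp [medOut])
      (by simp [medOut]) (by simp [medOut]) h1
  · refine nashStable_of_le_one hc ?_ ?_ ?_ ?_ ?_ h1 <;> norm_num [meanOut]
end
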